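/- For every integer n ≥ 1, the number of Catalan tableaux of index n equals the Catalan number C_n = (1/(n+1))·binomial(2n, n). -/

import Mathlib

/-- A binary tree: empty, or a root with a left and a right subtree. -/
inductive BinTree : Type
  | nil : BinTree
  | node : BinTree → BinTree → BinTree
  deriving DecidableEq

/-- Number of vertices of a binary tree. -/
def BinTree.size : BinTree → ℕ
  | .nil => 0
  | .node l r => l.size + r.size + 1

/-- Length (number of vertices) of the left branch. -/
def BinTree.leftBranchLen : BinTree → ℕ
  | .nil => 0
  | .node l _ => l.leftBranchLen + 1

/-- Length (number of vertices) of the right branch. -/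
def BinTree.rightBranchLen : BinTree → ℕ
  | .nil => 0
  | .node _ r => r.rightBranchLen + 1

/-- Word over {a,b} (a = `true`, b = `false`) reading the vertices in symmetric
(in-)order; a vertex contributes `true` iff it has a right child. -/
def BinTree.canopyFull : BinTree → List Bool
  | .nil => []
  | .node l r => l.canopyFull ++ (decide (r ≠ BinTree.nil)) :: r.canopyFull

/-- The canopy of a binary tree with `n` vertices: the word `u₁ … u_{n-1}` over
{a = `true`, b = `false`} with `uᵢ = a` iff the `i`-th vertex in symmetric order
has a right child.  (The last vertex in symmetric order never has a right child,
so it is dropped.) -/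
def BinTree.canopy (B : BinTree) : List Bool := B.canopyFull.dropLast

/-- A Catalan tableau of index `n`: a partition `λ₁ ≥ … ≥ λ_k` with `λ₁ = n - k`,
drawn right-justified inside the `k × (n-k)` rectangle (rows bottom to top, row `i`
having `lam i` cells, occupying columns `j` with `m - lam i ≤ j < m` where
`m = n - k`), filled with 0's (`false`) and 1's (`true`) such that every column
contains exactly one 1 and no 0 has both a 1 below it in its column and a 1 to
its right in its row.  Entries outside the diagram are forced to `false`. -/
structure CatalanTableau (n : ℕ) where
  k : ℕ
  m : ℕ
  hk : 0 < k
  hkm : k + m = n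
  lam : Fin k → ℕ
  lam_le : ∀ i, lam i ≤ m
  lam_first : lam ⟨0, hk⟩ = m
  lam_anti : ∀ i j : Fin k, i ≤ j → lam j ≤ lam i
  f : Fin k → Fin m → Bool
  f_outside : ∀ (i : Fin k) (j : Fin m), (j : ℕ) < m - lam i → f i j = false
  col_one : ∀ j : Fin m, ∃! i : Fin k, f i j = true
  no_bad : ∀ (i : Fin k) (j : Fin m), m - lam i ≤ (j : ℕ) → f i j = false →
    ¬ ((∃ i' : Fin k, i' < i ∧ f i' j = true) ∧
       (∃ j' : Fin m, (j : ℕ) < (j' : ℕ) ∧ f i j' = true))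

/-- The profile of a Catalan tableau: the NW border of its Ferrers diagram read
from the bottom-left corner of the rectangle to its top-right corner
(a = `true` for a north step, b = `false` for an east step), with the first
letter (always a north step) deleted. -/
def CatalanTableau.profile {n : ℕ} (T : CatalanTableau n) : List Bool :=
  ((List.finRange T.k).flatMap (fun i =>
    true :: List.replicate
      (T.lam i - (if h : (i : ℕ) + 1 < T.k then T.lam ⟨(i : ℕ) + 1, h⟩ else 0)) false)).tail

/-- Number of 1's in the first (bottom) row of a Catalan tableau. -/
noncomputable def CatalanTableau.onesFirstRow {n : ℕ} (T : CatalanTableau n) : ℕ :=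
  Nat.card {j : Fin T.m // T.f ⟨0, T.hk⟩ j = true}

/-- An entry is restricted if it is a 0 (in a cell of the diagram) lying above
some 1 in its column. -/
def CatalanTableau.Restricted {n : ℕ} (T : CatalanTableau n)
    (i : Fin T.k) (j : Fin T.m) : Prop :=
  T.m - T.lam i ≤ (j : ℕ) ∧ T.f i j = false ∧ ∃ i' : Fin T.k, i' < i ∧ T.f i' j = true

/-- Number of unrestricted rows (rows of the rectangle containing no restricted
entry). -/
noncomputable def CatalanTableau.unrestrictedRows {n : ℕ} (T : CatalanTableau n) : ℕ :=
  Nat.card {i : Fin T.k // ∀ j : Fin T.m, ¬ T.Restricted i j}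

/-- `weaklyBelow ω η`: the lattice paths coded by `ω`, `η` (a = `true` = north
step, b = `false` = east step, both starting at the origin) have the same
endpoints and `η` never passes strictly above `ω`. -/
def weaklyBelow (ω η : List Bool) : Prop :=
  η.length = ω.length ∧ η.count true = ω.count true ∧
    ∀ t : ℕ, (η.take t).count true ≤ (ω.take t).count true

/-- Heights at which the successive east steps of a path occur. -/
def eastHeightsAux : ℕ → List Bool → List ℕ
  | _, [] => []
  | h, true :: w => eastHeightsAux (h + 1) w
  | h, false :: w => h :: eastHeightsAux h w

def eastHeights (w : List Bool) : List ℕ := eastHeightsAux 0 w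

/-- Number of horizontal contacts of two paths: unit east edges traversed by
both paths. -/
def contacts (ω η : List Bool) : ℕ :=
  ((eastHeights ω).zip (eastHeights η)).countP (fun p => p.1 == p.2)

/-- Number of trailing north steps of a path. -/
def trailingNorth (w : List Bool) : ℕ := (w.reverse.takeWhile (· == true)).length

/-- Number of left edges, i.e. of vertices having a left child. -/
def BinTree.leftEdgeCount : BinTree → ℕ
  | .nil => 0
  | .node l r => l.leftEdgeCount + r.leftEdgeCount + (if l = BinTree.nil then 0 else 1)

/-- Number of vertices having no right child. -/
def BinTree.noRightCount : BinTree → ℕ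
  | .nil => 0
  | .node l r => l.noRightCount + r.noRightCount + (if r = BinTree.nil then 1 else 0)

/-- Symmetric-order traversal recording, for each vertex, whether it has a left
child, whether it has a right child, and its right height (the second argument
is the right height of the current root). -/
def BinTree.inorderAux : BinTree → ℕ → List (Bool × Bool × ℕ)
  | .nil, _ => []
  | .node l r, h =>
      BinTree.inorderAux l h ++
        (decide (l ≠ BinTree.nil), decide (r ≠ BinTree.nil), h) :: BinTree.inorderAux r (h + 1)

def BinTree.inorder (B : BinTree) : List (Bool × Bool × ℕ) := B.inorderAux 0

/-- The sequence `ρ₁, …, ρ_m`: right heights of the parents of the left edges,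
the left edges being ordered by their parents in symmetric order. -/
def BinTree.rhoList (B : BinTree) : List ℕ :=
  (B.inorder.filter (fun v => v.1)).map (fun v => v.2.2)

def hsAux : List (Bool × Bool × ℕ) → ℕ → List ℕ
  | [], _ => []
  | v :: rest, c => if v.2.1 then hsAux rest (c + 1) else c :: hsAux rest c

/-- The sequence `h₁, …, h_m`: for each vertex with no right child (in symmetric
order, excluding the last vertex in symmetric order), the number of vertices
preceding it in symmetric order that have a right child. -/
def BinTree.hList (B : BinTree) : List ℕ := (hsAux B.inorder 0).dropLast

/-- Leaves of the completion `γ(B)` in symmetric order, each recorded as `true`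
if it is a left child of its parent and `false` if it is a right child; the
boolean argument records whether the current subtree sits as a left child. -/
def BinTree.gammaLeavesAux : BinTree → Bool → List Bool
  | .nil, isLeft => [isLeft]
  | .node l r, _ => BinTree.gammaLeavesAux l true ++ BinTree.gammaLeavesAux r false

/-- The word of the leaves of the complete binary tree `γ(B)` in symmetric order
(a = `true` for a left child, b = `false` for a right child). -/
def BinTree.leafWord : BinTree → List Bool
  | .nil => []
  | .node l r => BinTree.gammaLeavesAux l true ++ BinTree.gammaLeavesAux r false

/-- The rows of a `k`-row tableau in which a new rightmost column may carry its `1`. Columns are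
recorded from right to left as pairs `(height, row of the 1)`. -/
def freeRows (k : ℕ) (L : List (ℕ × ℕ)) : Finset ℕ :=
  (Finset.range k).filter fun p => ∀ x ∈ L, p ≤ x.2 ∨ x.1 ≤ p

/-- `k` rows and the columns `L`, recorded from right to left as pairs `(height, row of the 1)`,
come from a Catalan tableau. -/
structure IsColumnCode (k : ℕ) (L : List (ℕ × ℕ)) : Prop where
  pos : 0 < k
  bounds : ∀ x ∈ L, x.2 < x.1 ∧ x.1 ≤ k
  pairwise : L.Pairwise fun x y => y.1 ≤ x.1 ∧ (x.2 ≤ y.2 ∨ y.1 ≤ x.2)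

/-- The column codes of the Catalan tableaux of index `s + 1`, generated by adding an empty top row
or a full rightmost column. -/
def columnCodes : ℕ → Finset (ℕ × List (ℕ × ℕ))
  | 0 => {(1, [])}
  | s + 1 => (columnCodes s).image (fun d => (d.1 + 1, d.2)) ∪
      ((columnCodes s).sigma fun d => freeRows d.1 d.2).image
        fun x => (x.1.1, (x.1.1, x.2) :: x.1.2)

theorem mem_columnCodes {s k : ℕ} {L : List (ℕ × ℕ)} :
    (k, L) ∈ columnCodes s ↔ IsColumnCode k L ∧ k + L.length = s + 1 := by
  induction s generalizing k L with
  | zero =>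
    simp only [columnCodes, Finset.mem_singleton, Prod.mk.injEq]
    constructor
    · rintro ⟨rfl, rfl⟩
      exact ⟨⟨one_pos, by simp, by simp⟩, rfl⟩
    · rintro ⟨⟨h, -, -⟩, h'⟩
      exact ⟨by omega, List.length_eq_zero_iff.1 (by omega)⟩
  | succ s ih =>
    simp only [columnCodes, Finset.mem_union, Finset.mem_image, Finset.mem_sigma, Prod.exists,
      Sigma.exists, Prod.mk.injEq, ih, freeRows, Finset.mem_filter, Finset.mem_range]
    constructor
    · rintro (⟨k, L, ⟨⟨h1, h2, h3⟩, h4⟩, rfl, rfl⟩ |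
        ⟨k, L, p, ⟨⟨⟨h1, h2, h3⟩, h4⟩, h5, h6⟩, rfl, rfl⟩)
      · exact ⟨⟨by omega, fun x hx => ⟨(h2 x hx).1, by have := (h2 x hx).2; omega⟩, h3⟩, by omega⟩
      · refine ⟨⟨h1, ?_, ?_⟩, by simp; omega⟩
        · simp only [List.mem_cons]
          rintro x (rfl | hx)
          · exact ⟨h5, le_rfl⟩
          · exact h2 x hx
        · exact List.pairwise_cons.2 ⟨fun x hx => ⟨(h2 x hx).2, h6 x hx⟩, h3⟩
    · rintro ⟨⟨h1, h2, h3⟩, h4⟩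
      by_cases hfull : ∃ p L', L = (k, p) :: L'
      · obtain ⟨p, L, rfl⟩ := hfull
        rw [List.pairwise_cons] at h3
        simp only [List.length_cons] at h4
        exact Or.inr ⟨k, L, p, ⟨⟨⟨h1, fun x hx => h2 x (List.mem_cons_of_mem _ hx), h3.2⟩,
          by omega⟩, (h2 _ List.mem_cons_self).1, fun x hx => (h3.1 x hx).2⟩, rfl, rfl⟩
      · have hlt : ∀ x ∈ L, x.1 < k := by
          cases L with
          | nil => simp
          | cons y L =>
            have hy : y.1 < k := lt_of_le_of_ne (h2 y List.mem_cons_self).2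
              fun h => hfull ⟨y.2, L, by rw [← h]⟩
            rw [List.pairwise_cons] at h3
            simp only [List.mem_cons]
            rintro x (rfl | hx)
            · exact hy
            · exact ((h3.1 x hx).1).trans_lt hy
        have hk : 1 < k := by
          cases L with
          | nil => simp at h4; omega
          | cons y L =>
            have := hlt y List.mem_cons_self
            have := (h2 y List.mem_cons_self).1
            omega
        refine Or.inl ⟨k - 1, L, ⟨⟨by omega, fun x hx => ⟨(h2 x hx).1, ?_⟩, h3⟩, by omega⟩,
          by omega, rfl⟩
        have := hlt x hx
        omega

theorem card_freeRows_succ {k : ℕ} {L : List (ℕ × ℕ)} (h : IsColumnCode k L) :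
    (freeRows (k + 1) L).card = (freeRows k L).card + 1 := by
  have : freeRows (k + 1) L = insert k (freeRows k L) := by
    ext p
    simp only [freeRows, Finset.mem_filter, Finset.mem_range, Finset.mem_insert]
    constructor
    · rintro ⟨h1, h2⟩
      by_cases hp : p = k
      · exact Or.inl hp
      · exact Or.inr ⟨by omega, h2⟩
    · rintro (rfl | ⟨h1, h2⟩)
      · exact ⟨by omega, fun x hx => Or.inr (h.bounds x hx).2⟩
      · exact ⟨by omega, h2⟩
  rw [this, Finset.card_insert_of_notMem (by simp [freeRows])]

theorem freeRows_cons (k p : ℕ) (L : List (ℕ × ℕ)) :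
    freeRows k ((k, p) :: L) = (freeRows k L).filter (· ≤ p) := by
  ext q
  simp only [freeRows, Finset.mem_filter, Finset.mem_range, List.forall_mem_cons]
  constructor
  · rintro ⟨h1, h2 | h2, h3⟩
    · exact ⟨⟨h1, h3⟩, h2⟩
    · omega
  · rintro ⟨⟨h1, h3⟩, h2⟩
    exact ⟨h1, Or.inl h2, h3⟩

theorem sum_card_filter_le (A : Finset ℕ) (g : ℕ → ℕ) :
    ∑ p ∈ A, g (A.filter (· ≤ p)).card = ∑ b ∈ Finset.range A.card, g (b + 1) := by
  induction A using Finset.induction_on_max with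
  | empty => simp
  | insert a A ha ih =>
    have hnot : a ∉ A := fun h => lt_irrefl _ (ha a h)
    rw [Finset.sum_insert hnot, Finset.card_insert_of_notMem hnot, Finset.sum_range_succ, ← ih,
      add_comm]
    congr 1
    · refine Finset.sum_congr rfl fun p hp => ?_
      rw [Finset.filter_insert, if_neg (not_le.2 (ha p hp))]
    · rw [Finset.filter_true_of_mem, Finset.card_insert_of_notMem hnot]
      simp only [Finset.mem_insert]
      rintro x (rfl | hx)
      · exact le_rfl
      · exact (ha x hx).le

/-- The number of ways to extend a tableau with `a` free rows by `s` rows and columns. -/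
def ballotCount : ℕ → ℕ → ℕ
  | 0, _ => 1
  | s + 1, a => ∑ b ∈ Finset.range (a + 1), ballotCount s (b + 1)

theorem sum_columnCodes_succ (s : ℕ) (g : ℕ → ℕ) :
    ∑ d ∈ columnCodes (s + 1), g (freeRows d.1 d.2).card =
      ∑ d ∈ columnCodes s, ∑ b ∈ Finset.range ((freeRows d.1 d.2).card + 1), g (b + 1) := by
  rw [columnCodes, Finset.sum_union, Finset.sum_image, Finset.sum_image, Finset.sum_sigma,
    ← Finset.sum_add_distrib]
  · refine Finset.sum_congr rfl ?_
    rintro ⟨k, L⟩ hd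
    simp only [freeRows_cons]
    rw [sum_card_filter_le, card_freeRows_succ (mem_columnCodes.1 hd).1, Finset.sum_range_succ,
      add_comm]
  · rintro ⟨⟨k, L⟩, p⟩ - ⟨⟨k', L'⟩, p'⟩ - h
    simp only [Prod.mk.injEq, List.cons.injEq] at h
    obtain ⟨rfl, ⟨-, rfl⟩, rfl⟩ := h
    rfl
  · rintro ⟨k, L⟩ - ⟨k', L'⟩ - h
    simp only [Prod.mk.injEq, Nat.add_right_cancel_iff] at h
    exact Prod.ext h.1 h.2
  · rw [Finset.disjoint_left]
    intro x h1 h2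
    obtain ⟨⟨k, L⟩, hd, rfl⟩ := Finset.mem_image.1 h1
    obtain ⟨⟨⟨k', L'⟩, p⟩, -, h⟩ := Finset.mem_image.1 h2
    simp only [Prod.mk.injEq] at h
    obtain ⟨rfl, rfl⟩ := h
    have := ((mem_columnCodes.1 hd).1.bounds _ List.mem_cons_self).2
    simp at this

theorem sum_columnCodes_ballotCount (s t : ℕ) :
    ∑ d ∈ columnCodes s, ballotCount t (freeRows d.1 d.2).card = ballotCount (s + t) 1 := by
  induction s generalizing t with
  | zero => simp [columnCodes, freeRows]
  | succ s ih =>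
    rw [sum_columnCodes_succ, show s + 1 + t = s + (t + 1) by omega, ← ih]
    rfl

theorem card_columnCodes (s : ℕ) : (columnCodes s).card = ballotCount s 1 := by
  simpa [ballotCount] using sum_columnCodes_ballotCount s 0

theorem ballotCount_succ_zero (s : ℕ) : ballotCount (s + 1) 0 = ballotCount s 1 := by
  simp [ballotCount]

theorem ballotCount_succ_succ (s a : ℕ) :
    ballotCount (s + 1) (a + 1) = ballotCount (s + 1) a + ballotCount s (a + 2) := by
  rw [ballotCount, Finset.sum_range_succ, ballotCount]

theorem ballotCount_add_choose (s a : ℕ) :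
    ballotCount (s + 1) a + (2 * s + 2 + a).choose s = (2 * s + 2 + a).choose (s + 1) := by
  induction s generalizing a with
  | zero => simp [ballotCount]; omega
  | succ s ih =>
    induction a with
    | zero =>
      have h := ih 1
      rw [ballotCount_succ_zero]
      have e1 : (2 * (s + 1) + 2 + 0).choose (s + 1) =
        (2 * s + 2 + 1).choose s + (2 * s + 2 + 1).choose (s + 1) := Nat.choose_succ_succ' _ _
      have e2 : (2 * (s + 1) + 2 + 0).choose (s + 1 + 1) =
        (2 * s + 2 + 1).choose (s + 1) + (2 * s + 2 + 1).choose (s + 1 + 1) :=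
        Nat.choose_succ_succ' _ _
      have e3 : (2 * s + 2 + 1).choose (s + 1) = (2 * s + 2 + 1).choose (s + 1 + 1) :=
        Nat.choose_symm_of_eq_add (by omega)
      omega
    | succ a iha =>
      have h := ih (a + 2)
      rw [ballotCount_succ_succ]
      have e0 : 2 * s + 2 + (a + 2) = 2 * (s + 1) + 2 + a := by omega
      rw [e0] at h
      have e1 : (2 * (s + 1) + 2 + (a + 1)).choose (s + 1) =
        (2 * (s + 1) + 2 + a).choose s + (2 * (s + 1) + 2 + a).choose (s + 1) :=
        Nat.choose_succ_succ' _ _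
      have e2 : (2 * (s + 1) + 2 + (a + 1)).choose (s + 1 + 1) =
        (2 * (s + 1) + 2 + a).choose (s + 1) + (2 * (s + 1) + 2 + a).choose (s + 1 + 1) :=
        Nat.choose_succ_succ' _ _
      omega

theorem ballotCount_one (s : ℕ) :
    ballotCount s 1 = (2 * (s + 1)).choose (s + 1) / (s + 1 + 1) := by
  have h := ballotCount_add_choose s 0
  rw [ballotCount_succ_zero, add_zero] at h
  have h2 := Nat.choose_succ_right_eq (2 * s + 2) s
  rw [show 2 * s + 2 - s = s + 2 by omega] at h2
  refine (Nat.div_eq_of_eq_mul_right (by omega) ?_).symm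
  rw [show 2 * (s + 1) = 2 * s + 2 by ring]
  nlinarith

theorem exists_threshold {k : ℕ} (P : Fin k → Prop) (hP : ∀ i j, i ≤ j → P j → P i) :
    ∃ c ≤ k, ∀ i : Fin k, (i : ℕ) < c ↔ P i := by
  classical
  have hex : ∃ c, ∀ h : c < k, ¬ P ⟨c, h⟩ := ⟨k, fun h => absurd h (lt_irrefl k)⟩
  refine ⟨Nat.find hex, Nat.find_min' hex fun h => absurd h (lt_irrefl k), fun i => ⟨fun h => ?_,
    fun h => ?_⟩⟩
  · have := Nat.find_min hex h
    push Not at this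
    exact this.2
  · by_contra hlt
    exact Nat.find_spec hex (by omega) (hP _ i (by simpa [Fin.le_def] using hlt) h)

namespace CatalanTableau

variable {n : ℕ} (T : CatalanTableau n)

theorem exists_height (j : Fin T.m) :
    ∃ c ≤ T.k, ∀ i : Fin T.k, (i : ℕ) < c ↔ T.m - T.lam i ≤ j :=
  exists_threshold _ fun i i' h h' => by
    have := T.lam_anti i i' h
    omega

/-- Number of cells in a column. -/
noncomputable def height (j : Fin T.m) : ℕ := (T.exists_height j).choose

theorem height_le (j : Fin T.m) : T.height j ≤ T.k := (T.exists_height j).choose_spec.1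

theorem lt_height (j : Fin T.m) (i : Fin T.k) : (i : ℕ) < T.height j ↔ T.m - T.lam i ≤ j :=
  (T.exists_height j).choose_spec.2 i

/-- The row of the `1` in a column. -/
noncomputable def oneRow (j : Fin T.m) : Fin T.k := (T.col_one j).choose

theorem f_eq_true_iff (i : Fin T.k) (j : Fin T.m) : T.f i j = true ↔ T.oneRow j = i :=
  ⟨fun h => ((T.col_one j).choose_spec.2 i h).symm, fun h => h ▸ (T.col_one j).choose_spec.1⟩

/-- The columns from right to left, as pairs `(height, row of the 1)`. -/
noncomputable def columns : List (ℕ × ℕ) :=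
  (List.ofFn fun j => (T.height j, (T.oneRow j : ℕ))).reverse

theorem length_columns : T.columns.length = T.m := by simp [columns]

theorem isColumnCode : IsColumnCode T.k T.columns where
  pos := T.hk
  bounds := by
    simp only [columns, List.mem_reverse, List.mem_ofFn]
    rintro _ ⟨j, rfl⟩
    refine ⟨?_, T.height_le j⟩
    rw [T.lt_height]
    by_contra h
    have h1 := T.f_outside (T.oneRow j) j (by omega)
    rw [(T.f_eq_true_iff _ j).2 rfl] at h1
    exact Bool.noConfusion h1
  pairwise := by
    rw [columns, List.pairwise_reverse, List.pairwise_ofFn]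
    intro j j' hj
    have hj' : (j : ℕ) < j' := hj
    constructor
    · by_contra! h
      have hk := T.height_le j
      have h1 := T.lt_height j ⟨T.height j', by omega⟩
      have h2 := T.lt_height j' ⟨T.height j', by omega⟩
      simp only at h1 h2
      omega
    · by_contra! h
      simp only at h
      refine T.no_bad (T.oneRow j') j ((T.lt_height _ _).1 h.2) ?_
        ⟨⟨T.oneRow j, h.1, (T.f_eq_true_iff _ _).2 rfl⟩, j', hj, (T.f_eq_true_iff _ _).2 rfl⟩
      rw [← Bool.not_eq_true, T.f_eq_true_iff]
      intro h'
      rw [h'] at h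
      exact lt_irrefl _ h.1

variable {T} in
theorem eq_of_columns_eq {T' : CatalanTableau n} (hk : T.k = T'.k)
    (hL : T.columns = T'.columns) : T = T' := by
  have hm : T.m = T'.m := by rw [← length_columns, hL, length_columns]
  have hlam := T.lam_le
  have hlam' := T'.lam_le
  have h1 := T.lt_height
  have h1' := T'.lt_height
  have h2 := T.f_eq_true_iff
  have h2' := T'.f_eq_true_iff
  unfold columns at hL
  generalize T.height = c at *
  generalize T'.height = c' at *
  generalize T.oneRow = p at *
  generalize T'.oneRow = p' at *
  obtain ⟨k, m, _, _, lam, _, _, _, f, _, _, _⟩ := T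
  obtain ⟨k', m', _, _, lam', _, _, _, f', _, _, _⟩ := T'
  dsimp only at *
  subst hk hm
  have hcp := List.ofFn_injective (List.reverse_injective hL)
  have hc : ∀ j, c j = c' j := fun j => congrArg Prod.fst (congrFun hcp j)
  have hp : ∀ j, p j = p' j := fun j => Fin.ext (congrArg Prod.snd (congrFun hcp j))
  have hf : f = f' := by
    funext i j
    rw [Bool.eq_iff_iff, h2, h2', hp]
  have hl : lam = lam' := by
    funext i
    have key : ∀ j : Fin m, m - lam i ≤ j ↔ m - lam' i ≤ j := fun j => by
      rw [← h1, ← h1', hc]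
    have ha := hlam i
    have hb := hlam' i
    rcases lt_trichotomy (lam i) (lam' i) with h | h | h
    · have := key ⟨m - lam' i, by omega⟩
      simp only at this
      omega
    · exact h
    · have := key ⟨m - lam i, by omega⟩
      simp only at this
      omega
  subst hf hl
  rfl

theorem exists_columns_eq {k : ℕ} {L : List (ℕ × ℕ)} (h : IsColumnCode k L)
    (hn : k + L.length = n) : ∃ T : CatalanTableau n, T.k = k ∧ T.columns = L := by
  obtain ⟨m, g, hg⟩ : ∃ m, ∃ g : Fin m → ℕ × ℕ, L = (List.ofFn g).reverse :=
    ⟨_, L.reverse.get, by rw [List.ofFn_get, List.reverse_reverse]⟩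
  subst hg
  obtain ⟨hk, hb, hpw⟩ := h
  rw [List.pairwise_reverse, List.pairwise_ofFn] at hpw
  simp only [List.mem_reverse, List.mem_ofFn, forall_exists_index, forall_apply_eq_imp_iff] at hb
  simp only [List.length_reverse, List.length_ofFn] at hn
  have hmono : ∀ j j' : Fin m, j ≤ j' → (g j).1 ≤ (g j').1 := fun j j' hj => by
    rcases hj.eq_or_lt with rfl | hj
    · exact le_rfl
    · exact (hpw hj).1
  have ht : ∀ i : Fin k, ∃ t ≤ m, ∀ j : Fin m, (j : ℕ) < t ↔ (g j).1 ≤ i := fun i =>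
    exists_threshold _ fun j j' hj hj' => (hmono j j' hj).trans hj'
  choose t htm ht using ht
  have hlam : ∀ (i : Fin k) (j : Fin m), m - (m - t i) ≤ j ↔ (i : ℕ) < (g j).1 := fun i j => by
    have := ht i j
    have := htm i
    omega
  let T : CatalanTableau n :=
    { k := k
      m := m
      hk := hk
      hkm := hn
      lam := fun i => m - t i
      lam_le := fun i => Nat.sub_le _ _
      lam_first := by
        have hm := htm ⟨0, hk⟩
        by_contra hne
        have h0 := (ht ⟨0, hk⟩ ⟨0, by omega⟩).1 (by simp only; omega)
        have h1 := hb ⟨0, by omega⟩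
        simp only at h0
        omega
      lam_anti := fun i i' hi => by
        by_contra! hlt
        have hm := htm i
        have hm' := htm i'
        have h0 := ht i ⟨t i', by omega⟩
        have h1 := ht i' ⟨t i', by omega⟩
        have hi' : (i : ℕ) ≤ i' := hi
        simp only at h0 h1
        omega
      f := fun i j => decide ((g j).2 = i)
      f_outside := fun i j hij => by
        have h0 := hlam i j
        have h1 := hb j
        simp only [decide_eq_false_iff_not]
        omega
      col_one := fun j => by
        have h1 := hb j
        refine ⟨⟨(g j).2, by omega⟩, by simp, fun i hi => ?_⟩
        simp only [decide_eq_true_eq] at hi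
        exact Fin.ext hi.symm
      no_bad := fun i j hij _ => by
        rintro ⟨⟨i', hi', h1⟩, j', hj', h2⟩
        simp only [decide_eq_true_eq] at h1 h2
        have h3 := (hpw (i := j) (j := j') hj').2
        have h4 := (hlam i j).1 hij
        have h5 : (i' : ℕ) < i := hi'
        omega }
  refine ⟨T, rfl, ?_⟩
  rw [columns]
  congr 2
  funext j
  refine Prod.ext ?_ ?_
  · have h1 := T.height_le j
    have h2 : (g j).1 ≤ T.k := (hb j).2
    have key : ∀ i : Fin T.k, (i : ℕ) < T.height j ↔ (i : ℕ) < (g j).1 := fun i =>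
      (T.lt_height j i).trans (hlam i j)
    rcases lt_trichotomy (T.height j) (g j).1 with h | h | h
    · have := key ⟨T.height j, by omega⟩
      simp only at this
      omega
    · exact h
    · have := key ⟨(g j).1, by omega⟩
      simp only at this
      omega
  · have := (T.f_eq_true_iff (T.oneRow j) j).2 rfl
    exact (of_decide_eq_true this).symm

theorem card_eq_card_columnCodes (s : ℕ) :
    Nat.card (CatalanTableau (s + 1)) = (columnCodes s).card := by
  let code : CatalanTableau (s + 1) → columnCodes s := fun T =>
    ⟨(T.k, T.columns), mem_columnCodes.2 ⟨T.isColumnCode, by rw [length_columns, T.hkm]⟩⟩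
  have hcode : Function.Bijective code := by
    constructor
    · intro T T' h
      have h' := Prod.ext_iff.1 (Subtype.ext_iff.1 h)
      exact eq_of_columns_eq h'.1 h'.2
    · rintro ⟨⟨k, L⟩, hd⟩
      obtain ⟨h, hn⟩ := mem_columnCodes.1 hd
      obtain ⟨T, hk, hL⟩ := exists_columns_eq h hn
      exact ⟨T, Subtype.ext (Prod.ext hk hL)⟩
  rw [Nat.card_congr (Equiv.ofBijective code hcode), Nat.card_eq_fintype_card, Fintype.card_coe]

end CatalanTableau

/-- For every integer `n ≥ 1`, the number of Catalan tableaux of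
index `n` equals the Catalan number `Cₙ = (1/(n+1))·binomial(2n, n)`. -/
theorem catalanTableau_card (n : ℕ) (hn : 1 ≤ n) :
    Nat.card (CatalanTableau n) = (2 * n).choose n / (n + 1) := by
  obtain ⟨s, rfl⟩ : ∃ s, n = s + 1 := ⟨n - 1, by omega⟩
  rw [CatalanTableau.card_eq_card_columnCodes, card_columnCodes, ballotCount_one]
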